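/- arXiv:2202.11627 — 3 statements merged into one kernel-verified Lean document; each statement's English description precedes it below -/
import Mathlib

section
/- Let b_n denote the number of D-equivalence classes of paths of length n in ℰ. For every odd n ≥ 3, b_n = C(n, (n−3)/2); for every even n ≥ 2, b_n = C(n, (n−4)/2) + C(n, n/2)/(n/2 + 1), with the convention that C(n, k) = 0 when k < 0. -/
/-- Steps of a Dyck path with catastrophes: up-step `U`, down-step `D`,
and catastrophe step `C k` of size `k` (valid paths only use `k ≥ 2`). -/
inductive Step where
  | U : Step
  | D : Step
  | C : ℕ → Step
  deriving DecidableEq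

/-- The vertical displacement of a step. -/
def Step.val : Step → ℤ
  | .U => 1
  | .D => -1
  | .C k => -(k : ℤ)

/-- The height (ordinate) of the path after its first `i` steps. -/
def hgt (P : List Step) (i : ℕ) : ℤ := ((P.take i).map Step.val).sum

/-- `InE P` means `P` is a Dyck path with catastrophes (a member of ℰ):
it stays at height ≥ 0, ends on the x-axis, and every catastrophe step
`C k` has `k ≥ 2` and starts at height `k` (hence ends on the x-axis). -/
def InE (P : List Step) : Prop :=
  (∀ i, 0 ≤ hgt P i) ∧ hgt P P.length = 0 ∧
    ∀ i k, P[i]? = some (Step.C k) → 2 ≤ k ∧ hgt P i = (k : ℤ)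

/-- `(UD)^k`. -/
def UDpow (k : ℕ) : List Step := (List.replicate k [Step.U, Step.D]).flatten

/-- `(DU)^k`. -/
def DUpow (k : ℕ) : List Step := (List.replicate k [Step.D, Step.U]).flatten

/-- `U^k`. -/
def Upow (k : ℕ) : List Step := List.replicate k Step.U

/-- `C_s` with the convention `C_1 = D`. -/
def cfin (s : ℕ) : Step := if s = 1 then Step.D else Step.C s

/-- Test whether a step is a catastrophe step. -/
def isCatB : Step → Bool
  | .C _ => true
  | _ => false

/-- The number of catastrophe steps in a path. -/
def catCount (P : List Step) : ℕ := P.countP isCatB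

/-- The number of equivalence classes, for the equivalence `E`, of paths of
length `n` in ℰ. -/
noncomputable def nClasses (E : List Step → List Step → Prop) (n : ℕ) : ℕ :=
  Nat.card (Quot (fun P Q : {P : List Step // InE P ∧ P.length = n} => E P.1 Q.1))

/-- Two paths are `D`-equivalent when their down-steps occur at the same positions. -/
def DEquiv (P Q : List Step) : Prop :=
  ∀ i : ℕ, P[i]? = some Step.D ↔ Q[i]? = some Step.D

theorem hgt_succ_of_some {P : List Step} {i : ℕ} {s : Step} (h : P[i]? = some s) :
    hgt P (i + 1) = hgt P i + s.val := by
  simp [hgt, List.take_add_one, h]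

theorem hgt_succ_of_none {P : List Step} {i : ℕ} (h : P[i]? = none) :
    hgt P (i + 1) = hgt P i := by
  simp [hgt, List.take_add_one, h]

theorem hgt_zero (P : List Step) : hgt P 0 = 0 := by simp [hgt]

theorem hgt_of_length_le {P : List Step} {i : ℕ} (h : P.length ≤ i) :
    hgt P i = hgt P P.length := by
  simp [hgt, List.take_of_length_le h]

theorem hgt_append_of_le (w : List Step) (s : Step) {i : ℕ} (h : i ≤ w.length) :
    hgt (w ++ [s]) i = hgt w i := by
  simp [hgt, List.take_append_of_le_length h]

theorem hgt_append_length (w : List Step) (s : Step) :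
    hgt (w ++ [s]) (w ++ [s]).length = hgt w w.length + s.val := by
  simp [hgt]

/-- Words in `U` and `D` that never go below the x-axis. -/
def IsBallot (w : List Step) : Prop :=
  (∀ s ∈ w, s = Step.U ∨ s = Step.D) ∧ ∀ i, 0 ≤ hgt w i

theorem isBallot_append (w : List Step) (s : Step) :
    IsBallot (w ++ [s]) ↔
      IsBallot w ∧ (s = Step.U ∨ (s = Step.D ∧ 1 ≤ hgt w w.length)) := by
  constructor
  · rintro ⟨hs, hh⟩
    refine ⟨⟨fun t ht => hs t (by simp [ht]), fun i => ?_⟩, ?_⟩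
    · rcases le_total i w.length with h | h
      · rw [← hgt_append_of_le w s h]; exact hh i
      · rw [hgt_of_length_le h, ← hgt_append_of_le w s le_rfl]; exact hh _
    · have h1 := hh (w ++ [s]).length
      rw [hgt_append_length] at h1
      rcases hs s (by simp) with rfl | rfl
      · exact Or.inl rfl
      · simp only [Step.val] at h1
        exact Or.inr ⟨rfl, by linarith⟩
  · rintro ⟨⟨hs, hh⟩, hw⟩
    refine ⟨fun t ht => ?_, fun i => ?_⟩
    · rcases List.mem_append.1 ht with ht | ht
      · exact hs t ht
      · rw [List.mem_singleton.1 ht]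
        exact hw.imp id And.left
    · rcases le_or_gt i w.length with h | h
      · rw [hgt_append_of_le w s h]; exact hh i
      · rw [hgt_of_length_le (by simpa using h), hgt_append_length]
        have := hh w.length
        rcases hw with rfl | ⟨rfl, h1⟩ <;> simp only [Step.val] <;> linarith

/-- Appending a fixed last step. -/
def snocEmb (s : Step) : List Step ↪ List Step :=
  ⟨fun w => w ++ [s], fun _ _ h => List.append_cancel_right h⟩

theorem snocEmb_apply (s : Step) (w : List Step) : snocEmb s w = w ++ [s] := rfl

theorem disjoint_map_snocEmb (A B : Finset (List Step)) :
    Disjoint (A.map (snocEmb Step.U)) (B.map (snocEmb Step.D)) := by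
  rw [Finset.disjoint_left]
  intro x hx hy
  obtain ⟨a, -, rfl⟩ := Finset.mem_map.1 hx
  obtain ⟨b, -, hb⟩ := Finset.mem_map.1 hy
  simp [snocEmb_apply] at hb

/-- The ballot words of length `n` whose final height is at least `h`. -/
def ballotWords : ℕ → ℕ → Finset (List Step)
  | 0, 0 => {[]}
  | 0, _ + 1 => ∅
  | n + 1, h =>
    ((ballotWords n (h - 1)).map (snocEmb Step.U)).disjUnion
      ((ballotWords n (h + 1)).map (snocEmb Step.D)) (disjoint_map_snocEmb _ _)

theorem mem_ballotWords (n h : ℕ) (w : List Step) :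
    w ∈ ballotWords n h ↔ IsBallot w ∧ w.length = n ∧ (h : ℤ) ≤ hgt w w.length := by
  induction n generalizing h w with
  | zero =>
    cases h with
    | zero =>
      simp only [ballotWords, Finset.mem_singleton]
      constructor
      · rintro rfl
        simp [IsBallot, hgt]
      · rintro ⟨-, h, -⟩
        exact List.length_eq_zero_iff.1 h
    | succ h =>
      simp only [ballotWords, Finset.notMem_empty, false_iff]
      rintro ⟨-, h1, h2⟩
      rw [h1, hgt_zero] at h2
      push_cast at h2
      omega
  | succ n ih =>
    rw [ballotWords]
    simp only [Finset.mem_disjUnion, Finset.mem_map, snocEmb_apply, ih]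
    constructor
    · rintro (⟨v, ⟨hv, hl, hh⟩, rfl⟩ | ⟨v, ⟨hv, hl, hh⟩, rfl⟩)
      · refine ⟨(isBallot_append _ _).2 ⟨hv, Or.inl rfl⟩, by simp [hl], ?_⟩
        rw [hgt_append_length, Step.val]
        omega
      · refine ⟨(isBallot_append _ _).2 ⟨hv, Or.inr ⟨rfl, by omega⟩⟩, by simp [hl], ?_⟩
        rw [hgt_append_length, Step.val]
        omega
    · rintro ⟨hw, hl, hh⟩
      rcases List.eq_nil_or_concat w with rfl | ⟨v, s, rfl⟩
      · simp at hl
      · rw [List.concat_eq_append] at *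
        rw [hgt_append_length] at hh
        obtain ⟨hv, hs⟩ := (isBallot_append _ _).1 hw
        have hl' : v.length = n := by simpa using hl
        have h0 := hv.2 v.length
        rcases hs with rfl | ⟨rfl, h1⟩
        · simp only [Step.val] at hh
          exact Or.inl ⟨v, ⟨hv, hl', by omega⟩, rfl⟩
        · simp only [Step.val] at hh
          exact Or.inr ⟨v, ⟨hv, hl', by omega⟩, rfl⟩

theorem card_ballotWords (n h : ℕ) :
    (ballotWords n h).card = if h ≤ n then n.choose ((n - h) / 2) else 0 := by
  induction n generalizing h with
  | zero => cases h <;> simp [ballotWords]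
  | succ n ih =>
    rw [ballotWords, Finset.card_disjUnion, Finset.card_map, Finset.card_map, ih, ih]
    rcases Nat.eq_zero_or_pos h with rfl | hpos
    · rcases Nat.even_or_odd' n with ⟨m, rfl | rfl⟩
      · cases m with
        | zero => simp
        | succ m =>
          rw [if_pos (by omega), if_pos (by omega), if_pos (by omega),
            show (2 * (m + 1) - (0 - 1)) / 2 = m + 1 by omega,
            show (2 * (m + 1) - (0 + 1)) / 2 = m by omega,
            show (2 * (m + 1) + 1 - 0) / 2 = m + 1 by omega, Nat.choose_succ_succ, add_comm]
      · rw [if_pos (by omega), if_pos (by omega), if_pos (by omega),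
          show (2 * m + 1 - (0 - 1)) / 2 = m by omega,
          show (2 * m + 1 - (0 + 1)) / 2 = m by omega,
          show (2 * m + 1 + 1 - 0) / 2 = m + 1 by omega, Nat.choose_succ_succ,
          Nat.choose_symm_half]
    · by_cases h1 : h + 1 ≤ n
      · obtain ⟨k, hk⟩ : ∃ k, (n - (h + 1)) / 2 = k := ⟨_, rfl⟩
        rw [if_pos (by omega), if_pos h1, if_pos (by omega), hk,
          show (n - (h - 1)) / 2 = k + 1 by omega,
          show (n + 1 - h) / 2 = k + 1 by omega, Nat.choose_succ_succ, add_comm]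
      · rw [if_neg h1]
        by_cases h2 : h ≤ n + 1
        · rw [if_pos (by omega), if_pos h2, show (n - (h - 1)) / 2 = 0 by omega,
            show (n + 1 - h) / 2 = 0 by omega]
          simp
        · rw [if_neg (by omega), if_neg h2]

/-- Replace every catastrophe step by an up-step. -/
def flat : Step → Step
  | .D => .D
  | _ => .U

theorem dEquiv_iff_map_flat {P Q : List Step} (h : P.length = Q.length) :
    DEquiv P Q ↔ P.map flat = Q.map flat := by
  rw [List.ext_getElem?_iff]
  refine forall_congr' fun i => ?_
  rw [List.getElem?_map, List.getElem?_map]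
  rcases lt_or_ge i P.length with hi | hi
  · rw [List.getElem?_eq_getElem hi, List.getElem?_eq_getElem (h ▸ hi)]
    cases P[i] <;> cases Q[i]'(h ▸ hi) <;> simp [flat]
  · rw [List.getElem?_eq_none hi, List.getElem?_eq_none (h ▸ hi)]
    simp

theorem InE.hgt_map_flat {P : List Step} (hP : InE P) (i : ℕ) :
    hgt (P.map flat) i = hgt P i ∨ hgt P i + 3 ≤ hgt (P.map flat) i := by
  induction i with
  | zero => simp [hgt_zero]
  | succ i ih =>
    rcases hs : P[i]? with _ | s
    · rwa [hgt_succ_of_none hs, hgt_succ_of_none (by simp [hs])]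
    · rw [hgt_succ_of_some hs, hgt_succ_of_some (s := flat s) (by simp [hs])]
      cases s with
      | U => simp only [flat, Step.val]; omega
      | D => simp only [flat, Step.val]; omega
      | C k =>
        obtain ⟨h1, h2⟩ := hP.2.2 i k hs
        simp only [flat, Step.val]
        omega

theorem InE.isBallot_map_flat {P : List Step} (hP : InE P) : IsBallot (P.map flat) := by
  refine ⟨fun s hs => ?_, fun i => ?_⟩
  · obtain ⟨t, -, rfl⟩ := List.mem_map.1 hs
    cases t <;> simp [flat]
  · have := hP.1 i
    rcases hP.hgt_map_flat i with h | h <;> omega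

theorem IsBallot.map_flat {w : List Step} (hw : IsBallot w) : w.map flat = w := by
  refine (List.map_congr_left fun s hs => ?_).trans (List.map_id w)
  rcases hw.1 s hs with rfl | rfl <;> rfl

theorem IsBallot.inE {w : List Step} (hw : IsBallot w) (h0 : hgt w w.length = 0) : InE w := by
  refine ⟨hw.2, h0, fun i k hk => ?_⟩
  rcases hw.1 _ (List.mem_of_getElem? hk) with h | h <;> simp at h

theorem hgt_set_of_le (w : List Step) (s : Step) {i j : ℕ} (h : j ≤ i) :
    hgt (w.set i s) j = hgt w j := by
  simp [hgt, List.take_set, List.set_eq_of_length_le, h]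

theorem hgt_set_of_lt (w : List Step) (s t : Step) {i j : ℕ} (hi : w[i]? = some t)
    (h : i < j) : hgt (w.set i s) j = hgt w j + (s.val - t.val) := by
  induction j, h using Nat.le_induction with
  | base =>
    have hl := (List.getElem?_eq_some_iff.1 hi).1
    rw [hgt_succ_of_some hi, hgt_succ_of_some (s := s) (by simp [hl]), hgt_set_of_le _ _ le_rfl]
    ring
  | succ j hj ih =>
    have hne : (w.set i s)[j]? = w[j]? := List.getElem?_set_ne (by omega)
    rcases hs : w[j]? with _ | r
    · rw [hgt_succ_of_none hs, hgt_succ_of_none (hne.trans hs), ih]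
    · rw [hgt_succ_of_some hs, hgt_succ_of_some (hne.trans hs), ih]
      ring

/-- The last passage of a ballot word to its final height. -/
theorem IsBallot.exists_last_passage {w : List Step} (hw : IsBallot w)
    (h : 0 < hgt w w.length) :
    ∃ i, w[i]? = some Step.U ∧ hgt w i = hgt w w.length - 1 ∧
      ∀ j, i < j → hgt w w.length ≤ hgt w j := by
  set m := hgt w w.length with hm
  have h0 : hgt w 0 ≤ m - 1 := by rw [hgt_zero]; omega
  have hspec := Nat.findGreatest_spec (P := fun i => hgt w i ≤ m - 1) (Nat.zero_le w.length) h0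
  have hmax : ∀ j, Nat.findGreatest (fun i => hgt w i ≤ m - 1) w.length < j →
      m ≤ hgt w j := by
    intro j hj
    rcases le_or_gt j w.length with hjl | hjl
    · have := Nat.findGreatest_is_greatest hj hjl
      omega
    · rw [hgt_of_length_le hjl.le]
  have hle := Nat.findGreatest_le (P := fun i => hgt w i ≤ m - 1) w.length
  generalize Nat.findGreatest (fun i => hgt w i ≤ m - 1) w.length = i at *
  have hlt : i < w.length := by
    rcases hle.lt_or_eq with h1 | rfl
    · exact h1
    · omega
  have hget := List.getElem?_eq_getElem hlt
  have hstep := hgt_succ_of_some hget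
  have hnext := hmax (i + 1) (Nat.lt_succ_self i)
  rcases hw.1 _ (List.getElem_mem hlt) with hu | hd
  · rw [hu] at hget hstep
    simp only [Step.val] at hstep
    exact ⟨i, hget, by omega, hmax⟩
  · rw [hd] at hstep
    simp only [Step.val] at hstep
    omega

theorem IsBallot.exists_inE {w : List Step} (hw : IsBallot w) (h : 3 ≤ hgt w w.length) :
    ∃ P, InE P ∧ P.map flat = w := by
  obtain ⟨i, hi, hh, hafter⟩ := hw.exists_last_passage (by omega)
  obtain ⟨k, hk⟩ : ∃ k : ℕ, hgt w i = k := ⟨_, (Int.toNat_of_nonneg (hw.2 i)).symm⟩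
  have hlt := (List.getElem?_eq_some_iff.1 hi).1
  have hset : ∀ j, i < j → hgt (w.set i (Step.C k)) j = hgt w j - hgt w w.length := by
    intro j hj
    rw [hgt_set_of_lt w _ _ hi hj]
    simp only [Step.val]
    omega
  refine ⟨w.set i (Step.C k), ⟨fun j => ?_, ?_, fun j l hl => ?_⟩, ?_⟩
  · rcases le_or_gt j i with hj | hj
    · rw [hgt_set_of_le _ _ hj]; exact hw.2 j
    · rw [hset j hj]
      have := hafter j hj
      omega
  · rw [List.length_set, hset _ hlt, sub_self]
  · by_cases hji : i = j
    · subst hji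
      rw [List.getElem?_set_self hlt] at hl
      obtain rfl : k = l := by simpa using hl
      rw [hgt_set_of_le _ _ le_rfl]
      exact ⟨by omega, hk⟩
    · rw [List.getElem?_set_ne hji] at hl
      rcases hw.1 _ (List.mem_of_getElem? hl) with h | h <;> simp at h
  · rw [List.map_set, hw.map_flat]
    apply List.ext_getElem?
    intro j
    by_cases hji : i = j
    · subst hji
      rw [List.getElem?_set_self hlt, hi]; rfl
    · rw [List.getElem?_set_ne hji]

theorem exists_inE_map_flat_iff (n : ℕ) (w : List Step) :
    (∃ P, (InE P ∧ P.length = n) ∧ P.map flat = w) ↔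
      w ∈ ballotWords n 3 ∪ (ballotWords n 0 \ ballotWords n 1) := by
  simp only [Finset.mem_union, Finset.mem_sdiff, mem_ballotWords]
  constructor
  · rintro ⟨P, ⟨hP, hl⟩, rfl⟩
    have hb := hP.isBallot_map_flat
    have hf := hP.hgt_map_flat P.length
    rw [hP.2.1] at hf
    simp only [List.length_map, hl] at hf ⊢
    rcases hf with hf | hf
    · exact Or.inr ⟨⟨hb, trivial, by simp [hf]⟩, by simp [hf]⟩
    · exact Or.inl ⟨hb, trivial, by simpa using hf⟩
  · rintro (⟨hb, hl, hh⟩ | ⟨⟨hb, hl, hh⟩, hn⟩)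
    · obtain ⟨P, hP, rfl⟩ := hb.exists_inE (by simpa using hh)
      exact ⟨P, ⟨hP, by simpa using hl⟩, rfl⟩
    · have h1 : ¬ (1 : ℤ) ≤ hgt w w.length := fun h => hn ⟨hb, hl, by simpa using h⟩
      exact ⟨w, ⟨hb.inE (by push_cast at hh; omega), hl⟩, hb.map_flat⟩

theorem ballotWords_subset {n h k : ℕ} (hk : h ≤ k) : ballotWords n k ⊆ ballotWords n h := by
  intro w hw
  rw [mem_ballotWords] at hw ⊢
  exact ⟨hw.1, hw.2.1, by have := hw.2.2; omega⟩

theorem nClasses_DEquiv (n : ℕ) :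
    nClasses DEquiv n =
      (ballotWords n 3).card + ((ballotWords n 0).card - (ballotWords n 1).card) := by
  let f : Quot (fun P Q : {P : List Step // InE P ∧ P.length = n} => DEquiv P.1 Q.1) →
      List Step := Quot.lift (fun P => P.1.map flat)
        fun P Q h => (dEquiv_iff_map_flat (P.2.2.trans Q.2.2.symm)).1 h
  have hf : Function.Injective f := by
    rintro ⟨P⟩ ⟨Q⟩ h
    exact Quot.sound ((dEquiv_iff_map_flat (P.2.2.trans Q.2.2.symm)).2 h)
  have hr : Set.range f =
      ((ballotWords n 3 ∪ (ballotWords n 0 \ ballotWords n 1) : Finset (List Step)) :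
        Set (List Step)) := by
    ext w
    rw [Finset.mem_coe, ← exists_inE_map_flat_iff]
    constructor
    · rintro ⟨⟨P⟩, rfl⟩
      exact ⟨P.1, P.2, rfl⟩
    · rintro ⟨P, hP, rfl⟩
      exact ⟨Quot.mk _ ⟨P, hP⟩, rfl⟩
  rw [nClasses, Nat.card_congr (Equiv.ofInjective f hf), hr, Nat.card_coe_set_eq,
    Set.ncard_coe_finset, Finset.card_union_of_disjoint,
    Finset.card_sdiff_of_subset (ballotWords_subset zero_le_one)]
  exact Finset.disjoint_sdiff.mono_left (ballotWords_subset (by norm_num))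

theorem choose_sub_choose_eq_div (m : ℕ) :
    (2 * (m + 1)).choose (m + 1) - (2 * (m + 1)).choose m =
      (2 * (m + 1)).choose (m + 1) / (m + 1 + 1) := by
  have h := Nat.choose_succ_right_eq (2 * (m + 1)) m
  rw [show 2 * (m + 1) - m = m + 2 by omega] at h
  symm
  apply Nat.div_eq_of_eq_mul_left (by omega)
  rw [Nat.sub_mul, ← h, ← Nat.mul_sub]
  simp


/-- Closed formula for the number `b n` of D-equivalence classes of paths of
length `n` in ℰ: for odd `n ≥ 3`, `b n = C(n, (n-3)/2)`; for even `n ≥ 2`,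
`b n = C(n, (n-4)/2) + C(n, n/2)/(n/2 + 1)`, where by convention the binomial
coefficient `C(n, (n-4)/2)` is `0` when `(n-4)/2 < 0`, i.e. when `n < 4`. -/
theorem count_DEquiv_classes (n : ℕ) :
    (n % 2 = 1 → 3 ≤ n → nClasses DEquiv n = Nat.choose n ((n - 3) / 2)) ∧
    (n % 2 = 0 → 2 ≤ n → nClasses DEquiv n =
      (if 4 ≤ n then Nat.choose n ((n - 4) / 2) else 0) +
        Nat.choose n (n / 2) / (n / 2 + 1)) := by
  constructor
  · intro hn h3
    rw [nClasses_DEquiv, card_ballotWords, card_ballotWords, card_ballotWords, if_pos h3,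
      if_pos (by omega), if_pos (by omega), show (n - 0) / 2 = (n - 1) / 2 by omega,
      Nat.sub_self, add_zero]
  · intro hn h2
    obtain ⟨m, rfl⟩ : ∃ m, n = 2 * (m + 1) := ⟨n / 2 - 1, by omega⟩
    rw [nClasses_DEquiv, card_ballotWords, card_ballotWords, card_ballotWords,
      if_pos (Nat.zero_le _), if_pos (by omega : 1 ≤ 2 * (m + 1)),
      show (2 * (m + 1) - 0) / 2 = m + 1 by omega,
      show (2 * (m + 1) - 1) / 2 = m by omega,
      show 2 * (m + 1) / 2 = m + 1 by omega, choose_sub_choose_eq_div]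
    congr 1
    by_cases h4 : 4 ≤ 2 * (m + 1)
    · rw [if_pos (by omega), if_pos h4,
        show (2 * (m + 1) - 3) / 2 = (2 * (m + 1) - 4) / 2 by omega]
    · rw [if_neg (by omega), if_neg h4]
end

section
/- Let f_n denote the number of UU-equivalence classes of paths of length n in ℰ. Then f_0 = 1, f_1 = 0, f_2 = 1, f_3 = 1, and f_n = f_{n−1} + f_{n−2} + f_{n−4} for all n ≥ 4. -/
/-- Two paths are `UU`-equivalent when the occurrences of the pattern `UU`
appear at the same positions in both paths. -/
def UUEquiv (P Q : List Step) : Prop :=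
  ∀ i : ℕ, (P[i]? = some Step.U ∧ P[i + 1]? = some Step.U) ↔
    (Q[i]? = some Step.U ∧ Q[i + 1]? = some Step.U)

/-- The suffix `P` of a path, starting at height `h`, is a valid completion to a path in ℰ. -/
def ValidFrom : ℕ → List Step → Prop
  | h, [] => h = 0
  | h, .U :: P => ValidFrom (h + 1) P
  | h, .D :: P => 1 ≤ h ∧ ValidFrom (h - 1) P
  | h, .C k :: P => 2 ≤ k ∧ h = k ∧ ValidFrom 0 P

theorem hgt_cons_succ (x : Step) (P : List Step) (i : ℕ) :
    hgt (x :: P) (i + 1) = x.val + hgt P i := by simp [hgt]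

theorem validFrom_iff (P : List Step) (h : ℕ) :
    ValidFrom h P ↔ (∀ i, 0 ≤ (h : ℤ) + hgt P i) ∧ (h : ℤ) + hgt P P.length = 0 ∧
      ∀ i k, P[i]? = some (Step.C k) → 2 ≤ k ∧ (h : ℤ) + hgt P i = (k : ℤ) := by
  induction P generalizing h with
  | nil => simp [ValidFrom, hgt]
  | cons x P ih =>
    have all_succ {p : ℕ → Prop} (h0 : p 0) : (∀ i, p i) ↔ ∀ i, p (i + 1) :=
      ⟨fun hp i => hp _, fun hp i => by cases i with
        | zero => exact h0
        | succ i => exact hp i⟩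
    rw [all_succ (p := fun i => 0 ≤ (h : ℤ) + hgt (x :: P) i) (by simp [hgt_zero])]
    cases x with
    | U =>
      rw [all_succ (p := fun i => ∀ k, (Step.U :: P)[i]? = some (Step.C k) → _) (by simp)]
      simp only [ValidFrom, ih, List.length_cons, hgt_cons_succ, List.getElem?_cons_succ,
        Step.val, Nat.cast_add, Nat.cast_one, add_assoc]
    | D =>
      rw [all_succ (p := fun i => ∀ k, (Step.D :: P)[i]? = some (Step.C k) → _) (by simp)]
      simp only [ValidFrom, ih, List.length_cons, hgt_cons_succ, List.getElem?_cons_succ,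
        Step.val, ← add_assoc]
      by_cases hh : 1 ≤ h
      · simp [hh, sub_eq_add_neg]
      · simp only [hh, false_and, false_iff, not_and]
        intro h1
        have := h1 0
        simp only [hgt_zero] at this
        omega
    | C k =>
      simp only [ValidFrom, ih, List.length_cons, hgt_cons_succ, Step.val, ← add_assoc]
      constructor
      · rintro ⟨hk, rfl, h1, h2, h3⟩
        refine ⟨by simpa using h1, by simpa using h2, fun i j hj => ?_⟩
        cases i with
        | zero =>
          obtain rfl : h = j := by simpa using hj
          simp [hgt_zero, hk]
        | succ i => simpa [hgt_cons_succ, Step.val] using h3 i j (by simpa using hj)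
      · rintro ⟨h1, h2, h3⟩
        obtain ⟨hk, hh⟩ := h3 0 k (by simp)
        obtain rfl : h = k := by simpa [hgt_zero] using hh
        refine ⟨hk, rfl, by simpa using h1, by simpa using h2, fun i j hj => ?_⟩
        simpa [hgt_cons_succ, Step.val] using h3 (i + 1) j (by simpa using hj)

theorem inE_iff_validFrom_zero (P : List Step) : InE P ↔ ValidFrom 0 P := by
  simp [validFrom_iff, InE]

/-- The word recording, for each step, whether the pattern `UU` occurs there. -/
def uuWord : List Step → List Bool
  | [] => []
  | x :: P => (x == .U && P.head? == some .U) :: uuWord P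

theorem length_uuWord (P : List Step) : (uuWord P).length = P.length := by
  induction P with
  | nil => rfl
  | cons x P ih => simp [uuWord, ih]

theorem getElem?_uuWord_eq_true (P : List Step) (i : ℕ) :
    (uuWord P)[i]? = some true ↔ P[i]? = some .U ∧ P[i + 1]? = some .U := by
  induction P generalizing i with
  | nil => simp [uuWord]
  | cons x P ih =>
    cases i with
    | zero => simp [uuWord, List.head?_eq_getElem?]
    | succ i => simpa [uuWord] using ih i

theorem uuEquiv_iff_uuWord_eq {P Q : List Step} (hl : P.length = Q.length) :
    UUEquiv P Q ↔ uuWord P = uuWord Q := by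
  simp only [UUEquiv, ← getElem?_uuWord_eq_true]
  refine ⟨fun h => ?_, fun h => by simp [h]⟩
  refine List.ext_getElem (by simp [length_uuWord, hl]) fun i h1 h2 => ?_
  have := h i
  simp only [List.getElem?_eq_getElem h1, List.getElem?_eq_getElem h2, Option.some.injEq] at this
  exact Bool.eq_iff_iff.mpr this

/-- States of an automaton recognising the words `uuWord P` for `P` in ℰ: an even number of
initial zeros, then blocks of at least one `1` followed by at least two `0`s. -/
inductive UUState where
  | evenZeros | oddZeros | ones | oneZero | zeros | dead

namespace UUState

/-- The transition function. -/
def next : UUState → Bool → UUState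
  | evenZeros, false => oddZeros
  | evenZeros, true => ones
  | oddZeros, false => evenZeros
  | oddZeros, true => dead
  | ones, false => oneZero
  | ones, true => ones
  | oneZero, false => zeros
  | oneZero, true => dead
  | zeros, false => zeros
  | zeros, true => ones
  | dead, _ => dead

/-- Acceptance of a word when starting from the given state. -/
def Accepts : UUState → List Bool → Prop
  | evenZeros, [] => True
  | zeros, [] => True
  | _, [] => False
  | s, b :: w => Accepts (s.next b) w

/-- The accepted words of a given length. -/
def words : UUState → ℕ → Finset (List Bool)
  | evenZeros, 0 => {[]}
  | zeros, 0 => {[]}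
  | _, 0 => ∅
  | s, n + 1 => (words (s.next false) n).image (List.cons false) ∪
      (words (s.next true) n).image (List.cons true)

theorem mem_words (s : UUState) (n : ℕ) (w : List Bool) :
    w ∈ s.words n ↔ s.Accepts w ∧ w.length = n := by
  induction n generalizing s w with
  | zero => cases s <;> cases w <;> simp [words, Accepts]
  | succ n ih =>
    cases w with
    | nil => simp [words]
    | cons b w => cases b <;> simp [words, Accepts, ih]

theorem card_words_succ (s : UUState) (n : ℕ) :
    (s.words (n + 1)).card = ((s.next false).words n).card + ((s.next true).words n).card := by
  rw [words, Finset.card_union_of_disjoint, Finset.card_image_of_injective _ List.cons_injective,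
    Finset.card_image_of_injective _ List.cons_injective]
  simp [Finset.disjoint_left]

theorem card_words_dead (n : ℕ) : (dead.words n).card = 0 := by
  induction n with
  | zero => rfl
  | succ n ih => simp [card_words_succ, next, ih]

theorem card_words_zeros_succ (n : ℕ) :
    (zeros.words (n + 1)).card =
      (evenZeros.words (n + 1)).card + (evenZeros.words n).card := by
  induction n with
  | zero => rfl
  | succ n ih =>
    rw [card_words_succ zeros, card_words_succ evenZeros (n + 1)]
    simp only [next, ih, card_words_succ oddZeros, card_words_dead]
    omega

theorem card_words_evenZeros_add_four (n : ℕ) :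
    (evenZeros.words (n + 4)).card = (evenZeros.words (n + 3)).card +
      (evenZeros.words (n + 2)).card + (evenZeros.words n).card := by
  have h1 (m : ℕ) : (evenZeros.words (m + 2)).card =
      (evenZeros.words m).card + (ones.words (m + 1)).card := by
    simp [card_words_succ evenZeros, card_words_succ oddZeros, next, card_words_dead]
  have h2 (m : ℕ) : (ones.words (m + 2)).card =
      (ones.words (m + 1)).card + (zeros.words m).card := by
    simp [card_words_succ ones (m + 1), card_words_succ oneZero, next, card_words_dead, add_comm]
  have : (evenZeros.words (n + 4)).card = _ + (ones.words (n + 3)).card := h1 (n + 2)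
  have : (evenZeros.words (n + 3)).card = _ + (ones.words (n + 2)).card := h1 (n + 1)
  have : (ones.words (n + 3)).card = (ones.words (n + 2)).card + _ := h2 (n + 1)
  have := card_words_zeros_succ n
  omega

theorem not_accepts_dead (w : List Bool) : ¬ dead.Accepts w := by
  induction w with
  | nil => simp [Accepts]
  | cons b w ih => exact ih

theorem accepts_evenZeros_or_oddZeros {w : List Bool} (hw : zeros.Accepts w) :
    evenZeros.Accepts w ∨ oddZeros.Accepts w := by
  induction w with
  | nil => simp [Accepts]
  | cons b w ih =>
    cases b with
    | false => exact (ih hw).symm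
    | true => exact Or.inl hw

end UUState

open UUState

theorem accepts_uuWord_of_validFrom (P : List Step) (h : ℕ) :
    (ValidFrom h P → zeros.Accepts (uuWord P)) ∧
      (ValidFrom h (.U :: P) → ones.Accepts (uuWord (.U :: P))) := by
  induction P generalizing h with
  | nil => simp [ValidFrom, uuWord, Accepts]
  | cons x P ih =>
    cases x with
    | U =>
      refine ⟨fun hv => ?_, (ih (h + 1)).2⟩
      match P with
      | [] => simp [ValidFrom] at hv
      | .U :: P => exact (ih h).2 hv
      | .D :: P => exact (ih _).1 hv
      | .C k :: P => exact (ih _).1 hv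
    | D => exact ⟨fun hv => (ih _).1 hv.2, fun hv => (ih _).1 hv.2⟩
    | C k => exact ⟨fun hv => (ih _).1 hv.2.2, fun hv => (ih _).1 hv.2.2⟩

theorem accepts_uuWord : ∀ P : List Step, ValidFrom 0 P → evenZeros.Accepts (uuWord P)
  | [], _ => trivial
  | [.U], hv => by simp [ValidFrom] at hv
  | .U :: .U :: P, hv => (accepts_uuWord_of_validFrom P 1).2 hv
  | .U :: .D :: P, hv => accepts_uuWord P hv.2
  | .U :: .C k :: P, hv => by
    simp only [ValidFrom] at hv
    omega
  | .D :: P, hv => by simp [ValidFrom] at hv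
  | .C k :: P, hv => by
    simp only [ValidFrom] at hv
    omega

theorem validFrom_cfin_cons {h : ℕ} (hh : 1 ≤ h) {P : List Step} (hP : ValidFrom 0 P) :
    ValidFrom h (cfin h :: P) := by
  unfold cfin
  split_ifs with h1
  · subst h1
    exact ⟨le_rfl, hP⟩
  · exact ⟨by omega, rfl, hP⟩

theorem cfin_ne_U (h : ℕ) : cfin h ≠ .U := by
  unfold cfin
  split_ifs <;> simp

theorem exists_uuWord_eq (w : List Bool) :
    (evenZeros.Accepts w → ∃ P, ValidFrom 0 P ∧ uuWord P = w) ∧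
      ∀ h, 1 ≤ h → ones.Accepts w → ∃ P, ValidFrom h (.U :: P) ∧ uuWord (.U :: P) = w := by
  induction hn : w.length using Nat.strong_induction_on generalizing w with
  | _ n ih =>
    subst hn
    refine ⟨fun hw => ?_, fun h hh hw => ?_⟩
    · match w with
      | [] => exact ⟨[], rfl, rfl⟩
      | [false] => exact hw.elim
      | false :: true :: w => exact (not_accepts_dead w hw).elim
      | false :: false :: w =>
        obtain ⟨P, hP, rfl⟩ := (ih _ (by simp) w rfl).1 hw
        exact ⟨.U :: .D :: P, ⟨le_rfl, hP⟩, by simp [uuWord]⟩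
      | true :: w =>
        obtain ⟨P, hP, rfl⟩ := (ih _ (by simp) w rfl).2 1 le_rfl hw
        exact ⟨.U :: .U :: P, hP, by simp [uuWord]⟩
    · match w with
      | [] => exact hw.elim
      | [false] => exact hw.elim
      | false :: true :: w => exact (not_accepts_dead w hw).elim
      | true :: w =>
        obtain ⟨P, hP, rfl⟩ := (ih _ (by simp) w rfl).2 (h + 1) (by omega) hw
        exact ⟨.U :: P, hP, by simp [uuWord]⟩
      | false :: false :: w =>
        rcases accepts_evenZeros_or_oddZeros (w := w) hw with hw | hw
        · obtain ⟨P, hP, rfl⟩ := (ih _ (by simp) w rfl).1 hw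
          exact ⟨.C (h + 1) :: P, ⟨by omega, rfl, hP⟩, by simp [uuWord]⟩
        · match w with
          | [] => exact hw.elim
          | true :: w => exact (not_accepts_dead w hw).elim
          | false :: w =>
            obtain ⟨P, hP, rfl⟩ := (ih _ (by simp; omega) w rfl).1 hw
            exact ⟨.D :: cfin h :: P, ⟨by omega, validFrom_cfin_cons hh hP⟩,
              by simp [uuWord, cfin_ne_U]⟩

theorem nClasses_UUEquiv (n : ℕ) : nClasses UUEquiv n = (evenZeros.words n).card := by
  have hmem (P : {P : List Step // InE P ∧ P.length = n}) : uuWord P.1 ∈ evenZeros.words n :=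
    (mem_words ..).2 ⟨accepts_uuWord _ ((inE_iff_validFrom_zero _).1 P.2.1),
      by rw [length_uuWord, P.2.2]⟩
  have hequiv (P Q : {P : List Step // InE P ∧ P.length = n}) :
      UUEquiv P.1 Q.1 ↔ uuWord P.1 = uuWord Q.1 :=
    uuEquiv_iff_uuWord_eq (P.2.2.trans Q.2.2.symm)
  rw [nClasses, ← Nat.card_eq_finsetCard]
  refine Nat.card_eq_of_bijective (Quot.lift (fun P => (⟨uuWord P.1, hmem P⟩ : evenZeros.words n))
    fun P Q h => Subtype.ext ((hequiv P Q).1 h)) ⟨?_, ?_⟩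
  · rintro ⟨P⟩ ⟨Q⟩ h
    exact Quot.sound ((hequiv P Q).2 (congrArg Subtype.val h))
  · rintro ⟨w, hw⟩
    obtain ⟨hacc, hlen⟩ := (mem_words ..).1 hw
    obtain ⟨P, hP, rfl⟩ := (exists_uuWord_eq w).1 hacc
    exact ⟨Quot.mk _ ⟨P, (inE_iff_validFrom_zero P).2 hP, by rw [← hlen, length_uuWord]⟩, rfl⟩

/-- The number `f n` of UU-equivalence classes of paths of length `n` in ℰ
satisfies `f 0 = 1`, `f 1 = 0`, `f 2 = 1`, `f 3 = 1` and
`f n = f (n-1) + f (n-2) + f (n-4)` for `n ≥ 4`. -/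
theorem count_UUEquiv_classes :
    nClasses UUEquiv 0 = 1 ∧ nClasses UUEquiv 1 = 0 ∧
    nClasses UUEquiv 2 = 1 ∧ nClasses UUEquiv 3 = 1 ∧
    ∀ n, 4 ≤ n → nClasses UUEquiv n =
      nClasses UUEquiv (n - 1) + nClasses UUEquiv (n - 2) + nClasses UUEquiv (n - 4) := by
  simp only [nClasses_UUEquiv]
  refine ⟨rfl, rfl, rfl, rfl, fun n hn => ?_⟩
  obtain ⟨m, rfl⟩ := Nat.exists_eq_add_of_le' hn
  exact card_words_evenZeros_add_four m
end

section
/- Let l_n denote the number of DD-equivalence classes of paths of length n in ℰ, and let L(x) = Σ_{n≥0} l_n x^n be the corresponding formal power series with rational coefficients. Then (x^{10} − x^9 + 4x^8 − 3x^7 + 5x^6 − 5x^5 + 2x^4 − 2x^3 + x^2 − x + 1) + (−x^{10} + x^9 − 6x^8 + 5x^7 − 9x^6 + 6x^5 − 3x^4 + 3x^3 + x − 1)·L(x) + (x^{10} − x^9 + 4x^8 − 3x^7 + 5x^6 − 3x^5 + 2x^4 − x^3)·L(x)^2 = 0 as formal power series. -/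
/-- Two paths are `DD`-equivalent when the occurrences of the pattern `DD`
appear at the same positions in both paths. -/
def DDEquiv (P Q : List Step) : Prop :=
  ∀ i : ℕ, (P[i]? = some Step.D ∧ P[i + 1]? = some Step.D) ↔
    (Q[i]? = some Step.D ∧ Q[i + 1]? = some Step.D)

namespace DyckCat

open PowerSeries

/-- `Valid h P`: the word `P`, started at height `h`, is a suffix of a path of `ℰ`. -/
def Valid : ℕ → List Step → Prop
  | h, [] => h = 0
  | h, Step.U :: P => Valid (h + 1) P
  | h, Step.D :: P => 1 ≤ h ∧ Valid (h - 1) P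
  | h, Step.C k :: P => 2 ≤ k ∧ h = k ∧ Valid 0 P

lemma hgt_nil (i : ℕ) : hgt [] i = 0 := by simp [hgt]

lemma hgt_zero (P : List Step) : hgt P 0 = 0 := by simp [hgt]

lemma hgt_cons_succ (s : Step) (P : List Step) (i : ℕ) :
    hgt (s :: P) (i + 1) = s.val + hgt P i := by simp [hgt]

lemma valid_iff (P : List Step) : ∀ h : ℕ, Valid h P ↔
    (∀ i, 0 ≤ (h : ℤ) + hgt P i) ∧ (h : ℤ) + hgt P P.length = 0 ∧
      ∀ i k, P[i]? = some (Step.C k) → 2 ≤ k ∧ (h : ℤ) + hgt P i = (k : ℤ) := by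
  induction P with
  | nil => intro h; simp [Valid, hgt_nil]
  | cons s P ih =>
    intro h
    have split_nat : ∀ p : ℕ → Prop, (∀ i, p i) ↔ p 0 ∧ ∀ i, p (i + 1) := fun p =>
      ⟨fun H => ⟨H 0, fun i => H _⟩, fun H i => by cases i; exacts [H.1, H.2 _]⟩
    rw [split_nat (fun i => 0 ≤ (h : ℤ) + hgt (s :: P) i),
      split_nat (fun i => ∀ k, (s :: P)[i]? = some (Step.C k) → _)]
    simp only [hgt_zero, hgt_cons_succ, List.length_cons, List.getElem?_cons_zero,
      List.getElem?_cons_succ, ← add_assoc]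
    cases s with
    | U =>
      rw [Valid, ih]
      simp [Step.val]
    | D =>
      rw [Valid, ih]
      simp only [Step.val]
      constructor
      · rintro ⟨h1, h2⟩
        push_cast [h1] at h2
        simpa [← sub_eq_add_neg] using h2
      · rintro ⟨⟨-, h2⟩, h3, -, h4⟩
        have h1 : 1 ≤ h := by
          have := h2 0
          rw [hgt_zero] at this
          omega
        refine ⟨h1, ?_⟩
        push_cast [h1]
        simpa [← sub_eq_add_neg] using ⟨h2, h3, h4⟩
    | C k =>
      rw [Valid, ih]
      simp only [Step.val]
      constructor
      · rintro ⟨h1, rfl, h2⟩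
        simpa [add_neg_cancel, h1] using h2
      · rintro ⟨⟨-, h2⟩, h3, h4, h5⟩
        obtain ⟨hk, hh⟩ := h4 k rfl
        have hh' : h = k := by simpa using hh
        subst hh'
        simp only [add_neg_cancel] at h2 h3 h5
        exact ⟨hk, rfl, h2, h3, h5⟩

lemma inE_iff_valid (P : List Step) : InE P ↔ Valid 0 P := by
  simp [valid_iff, InE]

/-- The indicator word of the positions where a `DD` ends; the flag `d` tells whether
the step before the word is a down-step. -/
def sig : Bool → List Step → List Bool
  | _, [] => []
  | d, s :: P => (d && decide (s = Step.D)) :: sig (decide (s = Step.D)) P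

lemma length_sig (P : List Step) : ∀ d, (sig d P).length = P.length := by
  induction P with
  | nil => intro; rfl
  | cons s P ih => intro; simp [sig, ih]

lemma sig_getElem?_succ (P : List Step) : ∀ d i, (sig d P)[i + 1]? = some true ↔
    P[i]? = some Step.D ∧ P[i + 1]? = some Step.D := by
  induction P with
  | nil => intro d i; simp [sig]
  | cons s P ih =>
    intro d i
    cases i with
    | zero => cases P <;> simp [sig]
    | succ i => simp [sig, ih]

lemma DDEquiv_iff_sig_eq {P Q : List Step} (h : P.length = Q.length) :
    DDEquiv P Q ↔ sig false P = sig false Q := by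
  constructor
  · intro H
    refine List.ext_getElem (by simp [length_sig, h]) fun i h1 h2 => ?_
    cases i with
    | zero => cases P <;> cases Q <;> first | rfl | simp at h
    | succ i =>
      have := H i
      rw [← sig_getElem?_succ P false, ← sig_getElem?_succ Q false,
        List.getElem?_eq_getElem h1, List.getElem?_eq_getElem h2] at this
      exact Bool.eq_iff_iff.2 (by simpa only [Option.some.injEq] using this)
  · intro H i
    rw [← sig_getElem?_succ P false, ← sig_getElem?_succ Q false, H]

/-- `Acc u v w`: some valid word has signature `w`, starting from a height in `u`
after a step other than `D`, or from a height in `v` after a down-step. -/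
def Acc (u v : Set ℕ) (w : List Bool) : Prop :=
  ∃ P : List Step, (∃ h ∈ u, Valid h P ∧ sig false P = w) ∨ (∃ h ∈ v, Valid h P ∧ sig true P = w)

lemma nClasses_eq_ncard (n : ℕ) :
    nClasses DDEquiv n = {w : List Bool | w.length = n ∧ Acc {0} ∅ w}.ncard := by
  rw [nClasses, ← Nat.card_coe_set_eq]
  refine Nat.card_congr (Equiv.ofBijective (Quot.lift
    (fun P => ⟨sig false P.1, by rw [length_sig, P.2.2],
      P.1, Or.inl ⟨0, rfl, (inE_iff_valid _).1 P.2.1, rfl⟩⟩) ?_) ⟨?_, ?_⟩)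
  · intro P Q h
    exact Subtype.ext ((DDEquiv_iff_sig_eq (P.2.2.trans Q.2.2.symm)).1 h)
  · rintro ⟨P⟩ ⟨Q⟩ h
    exact Quot.sound ((DDEquiv_iff_sig_eq (P.2.2.trans Q.2.2.symm)).2 (congrArg Subtype.val h))
  · rintro ⟨w, hw, P, ⟨h, rfl, hP, hs⟩ | ⟨h, h', -⟩⟩
    · refine ⟨Quot.mk _ ⟨P, (inE_iff_valid _).2 hP, ?_⟩, Subtype.ext hs⟩
      rw [← hw, ← hs, length_sig]
    · exact h'.elim

/-- Heights reachable by one non-`D` step. -/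
def nextUp (u v : Set ℕ) : Set ℕ :=
  {h | (1 ≤ h ∧ (h - 1 ∈ u ∨ h - 1 ∈ v)) ∨ (h = 0 ∧ ∃ k, 2 ≤ k ∧ (k ∈ u ∨ k ∈ v))}

/-- Heights reachable by one down-step. -/
def nextDown (u : Set ℕ) : Set ℕ := {h | h + 1 ∈ u}

lemma acc_nil (u v : Set ℕ) : Acc u v [] ↔ 0 ∈ u ∨ 0 ∈ v := by
  constructor
  · rintro ⟨_ | ⟨s, P⟩, ⟨h, hu, hP, hs⟩ | ⟨h, hu, hP, hs⟩⟩ <;> simp_all [Valid, sig]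
  · rintro (h | h)
    · exact ⟨[], Or.inl ⟨0, h, rfl, rfl⟩⟩
    · exact ⟨[], Or.inr ⟨0, h, rfl, rfl⟩⟩

lemma acc_cons_true (u v : Set ℕ) (w : List Bool) :
    Acc u v (true :: w) ↔ Acc ∅ (nextDown v) w := by
  constructor
  · rintro ⟨_ | ⟨s, P⟩, ⟨h, hu, hP, hs⟩ | ⟨h, hu, hP, hs⟩⟩
    · simp [sig] at hs
    · simp [sig] at hs
    · simp [sig] at hs
    · simp only [sig, Bool.true_and, List.cons.injEq, decide_eq_true_eq] at hs
      obtain ⟨rfl, hs⟩ := hs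
      refine ⟨P, Or.inr ⟨h - 1, ?_, hP.2, by simpa using hs⟩⟩
      simpa [nextDown, Nat.sub_add_cancel hP.1] using hu
  · rintro ⟨P, ⟨h, hu, -⟩ | ⟨h, hu, hP, hs⟩⟩
    · exact hu.elim
    · exact ⟨Step.D :: P, Or.inr ⟨h + 1, hu, ⟨by omega, hP⟩, by simp [sig, hs]⟩⟩

lemma acc_cons_false (u v : Set ℕ) (w : List Bool) :
    Acc u v (false :: w) ↔ Acc (nextUp u v) (nextDown u) w := by
  constructor
  · rintro ⟨_ | ⟨s, P⟩, ⟨h, hu, hP, hs⟩ | ⟨h, hu, hP, hs⟩⟩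
    · simp [sig] at hs
    · simp [sig] at hs
    · refine ⟨P, ?_⟩
      cases s with
      | U => exact Or.inl ⟨h + 1, Or.inl ⟨by omega, Or.inl hu⟩, hP, by simpa [sig] using hs⟩
      | D =>
        refine Or.inr ⟨h - 1, ?_, hP.2, by simpa [sig] using hs⟩
        simpa [nextDown, Nat.sub_add_cancel hP.1] using hu
      | C k =>
        obtain ⟨hk, rfl, hP⟩ := hP
        exact Or.inl ⟨0, Or.inr ⟨rfl, h, hk, Or.inl hu⟩, hP, by simpa [sig] using hs⟩
    · refine ⟨P, ?_⟩
      cases s with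
      | U => exact Or.inl ⟨h + 1, Or.inl ⟨by omega, Or.inr hu⟩, hP, by simpa [sig] using hs⟩
      | D => simp [sig] at hs
      | C k =>
        obtain ⟨hk, rfl, hP⟩ := hP
        exact Or.inl ⟨0, Or.inr ⟨rfl, h, hk, Or.inr hu⟩, hP, by simpa [sig] using hs⟩
  · rintro ⟨P, ⟨h, ⟨h1, hu⟩ | ⟨rfl, k, hk, hu⟩, hP, hs⟩ | ⟨h, hu, hP, hs⟩⟩
    · have hP' : Valid (h - 1) (Step.U :: P) := by
        rwa [Valid, Nat.sub_add_cancel h1]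
      refine ⟨Step.U :: P, hu.imp (fun hu => ⟨_, hu, hP', ?_⟩) (fun hu => ⟨_, hu, hP', ?_⟩)⟩ <;>
        simp [sig, hs]
    · have hP' : Valid k (Step.C k :: P) := ⟨hk, rfl, hP⟩
      refine ⟨Step.C k :: P, hu.imp (fun hu => ⟨_, hu, hP', ?_⟩) (fun hu => ⟨_, hu, hP', ?_⟩)⟩ <;>
        simp [sig, hs]
    · exact ⟨Step.D :: P, Or.inl ⟨h + 1, hu, ⟨by omega, hP⟩, by simp [sig, hs]⟩⟩

/-- The generating function of the words accepted from `(u, v)`. -/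
noncomputable def gf (u v : Set ℕ) : PowerSeries ℚ :=
  PowerSeries.mk fun n => ({w : List Bool | w.length = n ∧ Acc u v w}.ncard : ℚ)

lemma finite_acc (u v : Set ℕ) (n : ℕ) : {w : List Bool | w.length = n ∧ Acc u v w}.Finite :=
  (List.finite_length_eq Bool n).subset fun _ h => h.1

lemma ncard_acc_succ (u v : Set ℕ) (n : ℕ) :
    {w : List Bool | w.length = n + 1 ∧ Acc u v w}.ncard =
      {w : List Bool | w.length = n ∧ Acc (nextUp u v) (nextDown u) w}.ncard +
      {w : List Bool | w.length = n ∧ Acc ∅ (nextDown v) w}.ncard := by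
  have key : {w : List Bool | w.length = n + 1 ∧ Acc u v w} =
      List.cons false '' {w | w.length = n ∧ Acc (nextUp u v) (nextDown u) w} ∪
      List.cons true '' {w | w.length = n ∧ Acc ∅ (nextDown v) w} := by
    ext w
    rcases w with _ | ⟨_ | _, w⟩
    · simp
    · simp [acc_cons_false]
    · simp [acc_cons_true]
  rw [key, Set.ncard_union_eq ?_ ((finite_acc _ _ _).image _) ((finite_acc _ _ _).image _),
    Set.ncard_image_of_injective _ List.cons_injective,
    Set.ncard_image_of_injective _ List.cons_injective]
  rw [Set.disjoint_left]
  rintro _ ⟨w, -, rfl⟩ ⟨w', -, h⟩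
  simp at h

lemma coeff_zero_gf (u v : Set ℕ) [Decidable (0 ∈ u ∨ 0 ∈ v)] :
    coeff 0 (gf u v) = if 0 ∈ u ∨ 0 ∈ v then 1 else 0 := by
  have key : {w : List Bool | w.length = 0 ∧ Acc u v w} =
      if 0 ∈ u ∨ 0 ∈ v then {[]} else ∅ := by
    ext w
    cases w <;> split_ifs with h <;> simp [acc_nil, h]
  rw [gf, coeff_mk, key]
  split_ifs <;> simp

lemma gf_rec {u v u' v' v'' : Set ℕ} (h : nextUp u v = u') (h' : nextDown u = v')
    (h'' : nextDown v = v'') [Decidable (0 ∈ u ∨ 0 ∈ v)] :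
    gf u v = (if 0 ∈ u ∨ 0 ∈ v then 1 else 0) + X * (gf u' v' + gf ∅ v'') := by
  subst h h' h''
  ext n
  cases n with
  | zero =>
    rw [coeff_zero_gf]
    split_ifs <;> simp
  | succ n =>
    have : coeff (n + 1) (if 0 ∈ u ∨ 0 ∈ v then 1 else 0 : PowerSeries ℚ) = 0 := by
      split_ifs <;> simp [coeff_one]
    rw [map_add, this, coeff_succ_X_mul, map_add, zero_add]
    simp only [gf, coeff_mk]
    exact_mod_cast ncard_acc_succ u v n

lemma gf_rec_accepting {u v u' v' v'' : Set ℕ} (h0 : 0 ∈ u ∨ 0 ∈ v) (h : nextUp u v = u')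
    (h' : nextDown u = v') (h'' : nextDown v = v'') :
    gf u v = 1 + X * (gf u' v' + gf ∅ v'') := by
  classical
  rw [gf_rec h h' h'', if_pos h0]

lemma gf_rec_rejecting {u v u' v' v'' : Set ℕ} (h0 : ¬ (0 ∈ u ∨ 0 ∈ v)) (h : nextUp u v = u')
    (h' : nextDown u = v') (h'' : nextDown v = v'') :
    gf u v = X * (gf u' v' + gf ∅ v'') := by
  classical
  rw [gf_rec h h' h'', if_neg h0, zero_add]

lemma gf_empty : gf ∅ ∅ = 0 := by
  ext n
  simp [gf, Acc]

/-- The set `{0, …, m - 2} ∪ {m}`. -/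
def gap (m : ℕ) : Set ℕ := {h | h = m ∨ h + 2 ≤ m}

lemma nextUp_gap {u v : Set ℕ} {m : ℕ} (hm : 2 ≤ m) (h : u ∪ v = gap m) :
    nextUp u v = gap (m + 1) := by
  have h' : ∀ k, k ∈ u ∨ k ∈ v ↔ k = m ∨ k + 2 ≤ m := fun k => Set.ext_iff.1 h k
  ext k
  simp only [nextUp, Set.mem_ofPred_eq, h', gap]
  constructor
  · omega
  · intro hk
    rcases Nat.eq_zero_or_pos k with rfl | hk'
    · exact Or.inr ⟨rfl, m, hm, Or.inl rfl⟩
    · exact Or.inl ⟨hk', by omega⟩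

lemma nextUp_small {u v : Set ℕ} {m : ℕ} (hm : m ≤ 1) (h : u ∪ v = {m}) :
    nextUp u v = {m + 1} := by
  have h' : ∀ k, k ∈ u ∨ k ∈ v ↔ k = m := fun k => Set.ext_iff.1 h k
  ext k
  simp only [nextUp, Set.mem_ofPred_eq, h', Set.mem_singleton_iff]
  constructor
  · rintro (h | ⟨-, k, h⟩) <;> omega
  · intro; left; omega

lemma nextDown_gap (m : ℕ) : nextDown (gap (m + 1)) = gap m := by
  ext k; simp only [nextDown, gap, Set.mem_ofPred_eq]; omega

lemma nextDown_singleton (m : ℕ) : nextDown {m + 1} = {m} := by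
  ext k; simp [nextDown]

lemma nextDown_zero : nextDown {0} = ∅ := by
  ext k; simp [nextDown]

lemma nextDown_empty : nextDown ∅ = ∅ := rfl

lemma gap_zero : gap 0 = {0} := by ext k; simp [gap]

lemma gap_one : gap 1 = {1} := by
  ext k; simp only [gap, Set.mem_ofPred_eq, Set.mem_singleton_iff]; omega

lemma gf_A (h : ℕ) : gf (gap (h + 3)) (gap (h + 1)) =
    1 + X * (gf (gap (h + 4)) (gap (h + 2)) + gf ∅ (gap h)) := by
  refine gf_rec_accepting (Or.inl (Or.inr (by omega))) (nextUp_gap (by omega) ?_)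
    (nextDown_gap _) (nextDown_gap _)
  ext k; simp only [gap, Set.mem_union, Set.mem_ofPred_eq]; omega

lemma gf_B (m : ℕ) : gf ∅ (gap (m + 2)) =
    1 + X + X ^ 2 * gf (gap (m + 4)) (gap (m + 2)) + X * gf ∅ (gap (m + 1)) := by
  rw [gf_rec_accepting (Or.inr (Or.inr (by omega))) (nextUp_gap (by omega) (Set.empty_union _))
    nextDown_empty (nextDown_gap _), gf_rec_accepting (u := gap (m + 3))
    (Or.inl (Or.inr (by omega))) (nextUp_gap (by omega) (Set.union_empty _))
    (nextDown_gap _) nextDown_empty, gf_empty]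
  ring

lemma gf_one : gf {1} ∅ = X + X ^ 2 * gf (gap 3) (gap 1) := by
  have hI : nextUp {2} {0} = gap 3 := by
    ext k
    simp only [nextUp, Set.mem_ofPred_eq, Set.mem_singleton_iff, gap]
    constructor
    · rintro (h | h) <;> omega
    · intro hk
      rcases Nat.eq_zero_or_pos k with rfl | hk'
      · exact Or.inr ⟨rfl, 2, by simp⟩
      · exact Or.inl ⟨hk', by omega⟩
  rw [gf_rec_rejecting (by simp) (nextUp_small le_rfl (Set.union_empty _)) (nextDown_singleton 0)
    nextDown_empty, gf_rec_accepting (u := {2}) (by simp) hI (nextDown_singleton 1) nextDown_zero,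
    gf_empty, gap_one]
  ring

lemma gf_zero : gf {0} ∅ = 1 + X * gf {1} ∅ := by
  rw [gf_rec_accepting (by simp) (nextUp_small zero_le_one (Set.union_empty _)) nextDown_zero
    nextDown_empty, gf_empty, add_zero]

lemma gf_empty_zero : gf ∅ {0} = gf {0} ∅ := by
  rw [gf_zero, gf_rec_accepting (by simp) (nextUp_small zero_le_one (Set.empty_union _))
    nextDown_empty nextDown_zero, gf_empty, add_zero]

lemma gf_M : gf (gap 4) {2} = gf (gap 4) (gap 2) := by
  rw [gf_A 1, gap_one, gf_rec_accepting (Or.inl (Or.inr (by omega))) (nextUp_gap (m := 4)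
    (by omega) ?_) (nextDown_gap _) (nextDown_singleton _)]
  ext k; simp only [gap, Set.mem_union, Set.mem_ofPred_eq, Set.mem_singleton_iff]; omega

lemma gf_K : gf {0, 3} {1} = 1 + X * (gf (gap 4) (gap 2) + gf ∅ {0}) := by
  rw [← gf_M]
  refine gf_rec_accepting (by simp) ?_ ?_ (nextDown_singleton _)
  · ext k
    simp only [nextUp, Set.mem_ofPred_eq, Set.mem_singleton_iff, Set.mem_insert_iff, gap]
    constructor
    · rintro (h | h) <;> omega
    · intro hk
      rcases Nat.eq_zero_or_pos k with rfl | hk'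
      · exact Or.inr ⟨rfl, 3, by simp⟩
      · exact Or.inl ⟨hk', by omega⟩
  · ext k; simp [nextDown]

lemma gf_J : gf {2} ∅ = X * gf {0, 3} {1} := by
  rw [gf_rec_rejecting (by simp) ?_ (nextDown_singleton 1) nextDown_empty, gf_empty, add_zero]
  ext k
  simp only [nextUp, Set.mem_ofPred_eq, Set.mem_singleton_iff, Set.mem_insert_iff,
    Set.mem_empty_iff_false, or_false]
  constructor
  · rintro (h | h) <;> omega
  · rintro (rfl | rfl)
    · exact Or.inr ⟨rfl, 2, by simp⟩
    · exact Or.inl (by omega)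

lemma gf_empty_one : gf ∅ {1} =
    X ^ 2 * (1 + X * (gf (gap 4) (gap 2) + gf {0} ∅)) + X * gf {0} ∅ := by
  rw [gf_rec_rejecting (by simp) (nextUp_small le_rfl (Set.empty_union _)) nextDown_empty
    (nextDown_singleton 0), gf_J, gf_K, gf_empty_zero]
  ring

/-- If `u` satisfies the homogeneous linear recurrence with characteristic polynomial
`X r² - (1 + X²) r + (X + X³)`, then `u 1 / u 0` is a root of this polynomial. -/
lemma quadratic_of_recurrence (u : ℕ → PowerSeries ℚ)
    (hu : ∀ h, (1 + X ^ 2) * u (h + 1) = X * u (h + 2) + (X + X ^ 3) * u h) :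
    X * u 1 ^ 2 - (1 + X ^ 2) * u 0 * u 1 + (X + X ^ 3) * u 0 ^ 2 = 0 := by
  have hunit : IsUnit (1 + X ^ 2 : PowerSeries ℚ) := by
    simp [PowerSeries.isUnit_iff_constantCoeff]
  have hdvd : ∀ k h, X ^ k ∣ u (h + k) := by
    intro k
    induction k with
    | zero => simp
    | succ k ih =>
      intro h
      rw [← hunit.dvd_mul_left, ← add_assoc, hu, pow_succ']
      refine dvd_add (mul_dvd_mul_left _ ?_) ?_
      · have := ih (h + 2)
        rwa [show h + 2 + k = h + k + 2 by ring] at this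
      · rw [show (X + X ^ 3 : PowerSeries ℚ) = X * (1 + X ^ 2) by ring, mul_assoc]
        exact mul_dvd_mul_left _ ((ih h).mul_left _)
  have hQ : ∀ k, X * u (k + 1) ^ 2 - (1 + X ^ 2) * u k * u (k + 1) + (X + X ^ 3) * u k ^ 2 =
      (1 + X ^ 2) ^ k * (X * u 1 ^ 2 - (1 + X ^ 2) * u 0 * u 1 + (X + X ^ 3) * u 0 ^ 2) := by
    intro k
    induction k with
    | zero => simp
    | succ k ih =>
      refine mul_left_cancel₀ (X_ne_zero (R := ℚ)) ?_
      linear_combination (-X * u (k + 2) + (X + X ^ 3) * u k) * hu k + X * (1 + X ^ 2) * ih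
  ext n
  refine X_pow_dvd_iff.1 ?_ n (Nat.lt_succ_self n)
  rw [← (hunit.pow (n + 1)).dvd_mul_left, ← hQ]
  have h0 : X ^ (n + 1) ∣ u (n + 1) := by simpa using hdvd (n + 1) 0
  have h1 : X ^ (n + 1) ∣ u (n + 1 + 1) := by simpa [add_comm, add_left_comm] using hdvd (n + 1) 1
  exact dvd_add (dvd_sub ((dvd_pow h1 two_ne_zero).mul_left _) (h1.mul_left _))
    ((dvd_pow h0 two_ne_zero).mul_left _)

lemma quadratic_gf_gap :
    let u₄ : PowerSeries ℚ :=
      (1 - 2 * X + X ^ 2 - X ^ 3) * gf (gap 4) (gap 2) - (1 + X ^ 2)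
    let u₅ : PowerSeries ℚ :=
      (1 - 2 * X + X ^ 2 - X ^ 3) * gf (gap 5) (gap 3) - (1 + X ^ 2)
    X * u₅ ^ 2 - (1 + X ^ 2) * u₄ * u₅ + (X + X ^ 3) * u₄ ^ 2 = 0 := by
  refine quadratic_of_recurrence (fun h => (1 - 2 * X + X ^ 2 - X ^ 3) *
    gf (gap (h + 4)) (gap (h + 2)) - (1 + X ^ 2)) fun h => ?_
  linear_combination (1 - 2 * X + X ^ 2 - X ^ 3) * (gf_A (h + 2) + X * gf_B h - X * gf_A (h + 1))

lemma gf_gap_four : X ^ 4 * gf (gap 4) (gap 2) =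
    gf {0} ∅ * (1 - X ^ 4) - 1 - X ^ 2 - X ^ 3 := by
  have h3 := gf_A 0
  rw [gap_zero, gf_empty_zero] at h3
  linear_combination -gf_zero - X * gf_one - X ^ 3 * h3

lemma gf_gap_five : X * gf (gap 5) (gap 3) =
    gf (gap 4) (gap 2) - 1 - X * (X ^ 2 * (1 + X * (gf (gap 4) (gap 2) + gf {0} ∅)) +
      X * gf {0} ∅) := by
  have h4 := gf_A 1
  rw [gap_one, gf_empty_one] at h4
  linear_combination -h4

lemma gf_eq_mk_nClasses :
    (PowerSeries.mk fun n => (nClasses DDEquiv n : ℚ)) = gf {0} ∅ := by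
  simp only [gf, nClasses_eq_ncard]

end DyckCat

open PowerSeries in
/-- The generating function `L(x) = Σ l_n x^n` of the numbers `l n` of
DD-equivalence classes of paths of length `n` in ℰ satisfies the algebraic
equation
`(x¹⁰ - x⁹ + 4x⁸ - 3x⁷ + 5x⁶ - 5x⁵ + 2x⁴ - 2x³ + x² - x + 1)
 + (-x¹⁰ + x⁹ - 6x⁸ + 5x⁷ - 9x⁶ + 6x⁵ - 3x⁴ + 3x³ + x - 1)·L(x)
 + (x¹⁰ - x⁹ + 4x⁸ - 3x⁷ + 5x⁶ - 3x⁵ + 2x⁴ - x³)·L(x)² = 0`. -/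
theorem DDEquiv_gf_algebraic_equation :
    let L : PowerSeries ℚ := PowerSeries.mk fun n => (nClasses DDEquiv n : ℚ)
    let X : PowerSeries ℚ := PowerSeries.X
    (X ^ 10 - X ^ 9 + 4 * X ^ 8 - 3 * X ^ 7 + 5 * X ^ 6 - 5 * X ^ 5 + 2 * X ^ 4
        - 2 * X ^ 3 + X ^ 2 - X + 1)
      + (-X ^ 10 + X ^ 9 - 6 * X ^ 8 + 5 * X ^ 7 - 9 * X ^ 6 + 6 * X ^ 5 - 3 * X ^ 4
        + 3 * X ^ 3 + X - 1) * L
      + (X ^ 10 - X ^ 9 + 4 * X ^ 8 - 3 * X ^ 7 + 5 * X ^ 6 - 3 * X ^ 5 + 2 * X ^ 4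
        - X ^ 3) * L ^ 2 = 0 := by
  intro L X
  have hL : L = DyckCat.gf {0} ∅ := DyckCat.gf_eq_mk_nClasses
  have hQ := DyckCat.quadratic_gf_gap
  have h4 := DyckCat.gf_gap_four
  have h5 := DyckCat.gf_gap_five
  rw [← hL] at h4 h5
  change X ^ 4 * _ = L * (1 - X ^ 4) - 1 - X ^ 2 - X ^ 3 at h4
  change X * _ = _ - 1 - X * (X ^ 2 * (1 + X * (_ + L)) + X * L) at h5
  generalize DyckCat.gf (DyckCat.gap 4) (DyckCat.gap 2) = a at hQ h4 h5
  generalize DyckCat.gf (DyckCat.gap 5) (DyckCat.gap 3) = b at hQ h5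
  change X * ((1 - 2 * X + X ^ 2 - X ^ 3) * b - (1 + X ^ 2)) ^ 2
    - (1 + X ^ 2) * ((1 - 2 * X + X ^ 2 - X ^ 3) * a - (1 + X ^ 2))
      * ((1 - 2 * X + X ^ 2 - X ^ 3) * b - (1 + X ^ 2))
    + (X + X ^ 3) * ((1 - 2 * X + X ^ 2 - X ^ 3) * a - (1 + X ^ 2)) ^ 2 = 0 at hQ
  have hX : X ≠ 0 := PowerSeries.X_ne_zero
  have hd : (1 - 2 * X + X ^ 2 - X ^ 3 : PowerSeries ℚ) ≠ 0 := by
    intro h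
    simpa [X] using congrArg PowerSeries.constantCoeff h
  refine mul_left_cancel₀ (mul_ne_zero (pow_ne_zero 6 hX) hd) ?_
  clear_value X L
  have h5' : X ^ 5 * b = (1 - X ^ 4) * (L * (1 - X ^ 4) - 1 - X ^ 2 - X ^ 3)
      - X ^ 4 * (1 + X ^ 3 + X ^ 4 * L + X ^ 2 * L) := by
    linear_combination X ^ 4 * h5 + (1 - X ^ 4) * h4
  have key : ∀ p q : PowerSeries ℚ, p = L * (1 - X ^ 4) - 1 - X ^ 2 - X ^ 3 →
      q = (1 - X ^ 4) * (L * (1 - X ^ 4) - 1 - X ^ 2 - X ^ 3)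
        - X ^ 4 * (1 + X ^ 3 + X ^ 4 * L + X ^ 2 * L) →
      X ^ 6 * (1 - 2 * X + X ^ 2 - X ^ 3) *
        ((X ^ 10 - X ^ 9 + 4 * X ^ 8 - 3 * X ^ 7 + 5 * X ^ 6 - 5 * X ^ 5 + 2 * X ^ 4
          - 2 * X ^ 3 + X ^ 2 - X + 1)
        + (-X ^ 10 + X ^ 9 - 6 * X ^ 8 + 5 * X ^ 7 - 9 * X ^ 6 + 6 * X ^ 5 - 3 * X ^ 4
          + 3 * X ^ 3 + X - 1) * L
        + (X ^ 10 - X ^ 9 + 4 * X ^ 8 - 3 * X ^ 7 + 5 * X ^ 6 - 3 * X ^ 5 + 2 * X ^ 4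
          - X ^ 3) * L ^ 2) =
      -(X * ((1 - 2 * X + X ^ 2 - X ^ 3) * q - X ^ 5 * (1 + X ^ 2)) ^ 2
        - (1 + X ^ 2) * ((1 - 2 * X + X ^ 2 - X ^ 3) * (X * p) - X ^ 5 * (1 + X ^ 2))
          * ((1 - 2 * X + X ^ 2 - X ^ 3) * q - X ^ 5 * (1 + X ^ 2))
        + (X + X ^ 3) * ((1 - 2 * X + X ^ 2 - X ^ 3) * (X * p) - X ^ 5 * (1 + X ^ 2)) ^ 2) := by
    rintro _ _ rfl rfl
    ring
  rw [key _ _ h4 h5']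
  linear_combination -X ^ 10 * hQ
end
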